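/- arXiv:2412.11804 — 2 statements merged into one kernel-verified Lean document; each statement's English description precedes it below -/
import Mathlib

section
/- Let t̄ > 0, κ > 0, u_max ≥ 0, p^k ∈ ℝ, and let p, v : [0, t̄) → ℝ be differentiable with p′(t) = v(t) and v′(t) = u(t), where u : [0, t̄) → ℝ satisfies u(t) ≥ κ((p^k − p(t))/(t̄ − t) − (u_max/2)(t̄ − t) − v(t)) + ((p^k − p(t)) − v(t)(t̄ − t))/(t̄ − t)² + u_max/2 for all t ∈ [0, t̄). If v(0) ≥ (p^k − p(0))/t̄ − (u_max/2) t̄, then for every t ∈ [0, t̄): p^k − p(t) ≤ v(t)(t̄ − t) + (u_max/2)(t̄ − t)². -/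
/-- Comparison lemma for the scalar differential inequality `h' ≥ -κ h`: nonnegativity of `h` at
the left endpoint of a half-open interval propagates to the whole interval. -/
theorem nonneg_of_hasDerivAt_of_neg_mul_le {h h' : ℝ → ℝ} {κ a b : ℝ}
    (hh : ∀ t ∈ Set.Ico a b, HasDerivAt h (h' t) t)
    (hle : ∀ t ∈ Set.Ico a b, -κ * h t ≤ h' t) (ha : 0 ≤ h a) :
    ∀ t ∈ Set.Ico a b, 0 ≤ h t := by
  intro t ht
  have hd : ∀ s ∈ Set.Ico a b, HasDerivAt (fun s => h s * Real.exp (κ * s))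
      (h' s * Real.exp (κ * s) + h s * (Real.exp (κ * s) * (κ * 1))) s := fun s hs =>
    (hh s hs).mul ((hasDerivAt_id s).const_mul κ).exp
  have hmono : MonotoneOn (fun s => h s * Real.exp (κ * s)) (Set.Ico a b) := by
    refine monotoneOn_of_deriv_nonneg (convex_Ico a b)
      (fun s hs => (hd s hs).continuousAt.continuousWithinAt)
      (fun s hs => (hd s (interior_subset hs)).differentiableAt.differentiableWithinAt) ?_
    intro s hs
    have hs' := interior_subset hs
    rw [(hd s hs').deriv]
    have := mul_nonneg (sub_nonneg.2 (hle s hs')) (Real.exp_pos (κ * s)).le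
    linarith
  have hat := hmono ⟨le_rfl, ht.1.trans_lt ht.2⟩ ht ht.1
  exact nonneg_of_mul_nonneg_left ((mul_nonneg ha (Real.exp_pos _).le).trans hat)
    (Real.exp_pos _)

/-- Derivative of the latest-departure barrier function along double-integrator dynamics. -/
theorem hasDerivAt_latestDepartureBarrier {tbar umax pk t a : ℝ} {p v : ℝ → ℝ}
    (hp : HasDerivAt p (v t) t) (hv : HasDerivAt v a t) (ht : t < tbar) :
    HasDerivAt (fun s => v s - (pk - p s) / (tbar - s) + umax / 2 * (tbar - s))
      (a - ((pk - p t) - v t * (tbar - t)) / (tbar - t) ^ 2 - umax / 2) t := by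
  have hτ : tbar - t ≠ 0 := (sub_pos.2 ht).ne'
  have hd := (hasDerivAt_id t).const_sub tbar
  refine ((hv.sub ((hp.const_sub pk).div hd hτ)).add (hd.const_mul (umax / 2))).congr_deriv ?_
  simp only [id]
  ring


/-- Theorem 2 (latest departure guarantee): the CBF lower bound on `u` renders the
latest-departure motion-primitive condition forward invariant. -/
theorem stmt_11 (tbar κ umax pk : ℝ) (htbar : 0 < tbar) (hκ : 0 < κ) (humax : 0 ≤ umax)
    (p v u : ℝ → ℝ)
    (hp : ∀ t : ℝ, 0 ≤ t → t < tbar → HasDerivAt p (v t) t)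
    (hv : ∀ t : ℝ, 0 ≤ t → t < tbar → HasDerivAt v (u t) t)
    (hu : ∀ t : ℝ, 0 ≤ t → t < tbar →
      u t ≥ κ * ((pk - p t) / (tbar - t) - (umax / 2) * (tbar - t) - v t)
        + ((pk - p t) - v t * (tbar - t)) / (tbar - t) ^ 2 + umax / 2)
    (h0 : v 0 ≥ (pk - p 0) / tbar - (umax / 2) * tbar) :
    ∀ t : ℝ, 0 ≤ t → t < tbar →
      pk - p t ≤ v t * (tbar - t) + (umax / 2) * (tbar - t) ^ 2 := by
  intro t ht0 ht
  have hτ : 0 < tbar - t := sub_pos.2 ht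
  have hnonneg := nonneg_of_hasDerivAt_of_neg_mul_le (κ := κ) (a := 0) (b := tbar)
    (fun s hs => hasDerivAt_latestDepartureBarrier (umax := umax) (pk := pk)
      (hp s hs.1 hs.2) (hv s hs.1 hs.2) hs.2)
    (fun s hs => by linarith [hu s hs.1 hs.2])
    (by simp only [sub_zero]; linarith) t ⟨ht0, ht⟩
  have hle : (pk - p t) / (tbar - t) ≤ v t + umax / 2 * (tbar - t) := by linarith
  rw [div_le_iff₀ hτ] at hle
  linarith
end

section
/- Let t̲ > 0, κ > 0, u_max ≥ 0, p^k ∈ ℝ, and let p, v : [0, t̲) → ℝ be differentiable with p′(t) = v(t) and v′(t) = u(t), where u : [0, t̲) → ℝ satisfies u(t) ≤ −κ(v(t) − (p^k − p(t))/(t̲ − t) − (u_max/2)(t̲ − t)) + ((p^k − p(t)) − v(t)(t̲ − t))/(t̲ − t)² − u_max/2 for all t ∈ [0, t̲). If v(0) ≤ (p^k − p(0))/t̲ + (u_max/2) t̲, then for every t ∈ [0, t̲): v(t)(t̲ − t) − (u_max/2)(t̲ − t)² ≤ p^k − p(t). -/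
/-- Grönwall-type comparison: if `g' ≤ -κ g` on `[0, T)` and `g 0 ≤ 0`, then `g ≤ 0` on `[0, T)`. -/
theorem nonpos_of_deriv_le_neg_mul {g g' : ℝ → ℝ} {κ T : ℝ}
    (hg : ∀ t : ℝ, 0 ≤ t → t < T → HasDerivAt g (g' t) t)
    (hle : ∀ t : ℝ, 0 ≤ t → t < T → g' t ≤ -κ * g t) (h0 : g 0 ≤ 0) :
    ∀ t : ℝ, 0 ≤ t → t < T → g t ≤ 0 := by
  intro t ht htT
  have hd : ∀ x ∈ Set.Ico 0 T, HasDerivAt (fun x => g x * Real.exp (κ * x))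
      (g' x * Real.exp (κ * x) + g x * (Real.exp (κ * x) * (κ * 1))) x := fun x hx =>
    (hg x hx.1 hx.2).mul ((hasDerivAt_id x).const_mul κ).exp
  have hanti : AntitoneOn (fun x => g x * Real.exp (κ * x)) (Set.Ico 0 T) := by
    refine antitoneOn_of_deriv_nonpos (convex_Ico 0 T)
      (fun x hx => (hd x hx).continuousAt.continuousWithinAt)
      (fun x hx => (hd x (interior_subset hx)).differentiableAt.differentiableWithinAt) ?_
    intro x hx
    have hx' := interior_subset hx
    rw [(hd x hx').deriv]
    nlinarith [hle x hx'.1 hx'.2, Real.exp_pos (κ * x)]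
  have h := hanti ⟨le_rfl, ht.trans_lt htT⟩ ⟨ht, htT⟩ ht
  simp only [mul_zero, Real.exp_zero, mul_one] at h
  exact nonpos_of_mul_nonpos_left (h.trans h0) (Real.exp_pos _)


/-- Theorem 2 (earliest arrival guarantee): the CBF upper bound on `u` renders the
earliest-arrival motion-primitive condition forward invariant. -/
theorem stmt_12 (tund κ umax pk : ℝ) (htund : 0 < tund) (hκ : 0 < κ) (humax : 0 ≤ umax)
    (p v u : ℝ → ℝ)
    (hp : ∀ t : ℝ, 0 ≤ t → t < tund → HasDerivAt p (v t) t)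
    (hv : ∀ t : ℝ, 0 ≤ t → t < tund → HasDerivAt v (u t) t)
    (hu : ∀ t : ℝ, 0 ≤ t → t < tund →
      u t ≤ -κ * (v t - (pk - p t) / (tund - t) - (umax / 2) * (tund - t))
        + ((pk - p t) - v t * (tund - t)) / (tund - t) ^ 2 - umax / 2)
    (h0 : v 0 ≤ (pk - p 0) / tund + (umax / 2) * tund) :
    ∀ t : ℝ, 0 ≤ t → t < tund →
      v t * (tund - t) - (umax / 2) * (tund - t) ^ 2 ≤ pk - p t := by
  intro t ht htT
  have hg : ∀ x : ℝ, 0 ≤ x → x < tund →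
      HasDerivAt (fun x => v x - (pk - p x) / (tund - x) - (umax / 2) * (tund - x))
        (u x - ((pk - p x) - v x * (tund - x)) / (tund - x) ^ 2 + umax / 2) x := by
    intro x hx hxT
    have hs : tund - x ≠ 0 := (sub_pos.2 hxT).ne'
    have hsub : HasDerivAt (fun x => tund - x) (-1) x := (hasDerivAt_id x).const_sub tund
    refine (((hv x hx hxT).sub (((hp x hx hxT).const_sub pk).div hsub hs)).sub
      (hsub.const_mul (umax / 2))).congr_deriv ?_
    field_simp
    ring
  have hneg := nonpos_of_deriv_le_neg_mul (κ := κ) hg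
    (fun x hx hxT => by linarith [hu x hx hxT]) (by simp only [sub_zero]; linarith) t ht htT
  have hs : 0 < tund - t := sub_pos.2 htT
  have hmul := mul_nonpos_of_nonpos_of_nonneg hneg hs.le
  have hdiv : (pk - p t) / (tund - t) * (tund - t) = pk - p t := div_mul_cancel₀ _ hs.ne'
  linarith
end
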